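/- Let (M,Q) be a nondegenerate finite quadratic module and let U ≤ M be an isotropic subgroup. Then: (i) for x ∈ U^⊥ the value Q(x) depends only on the coset x + U, so Q̄(x+U) := Q(x) is a well-defined quadratic form on U^⊥/U, and (U^⊥/U, Q̄) is again a nondegenerate finite quadratic module; (ii) |M| = |U|² · |U^⊥/U|; (iii) σ(M) = σ(U^⊥/U). In particular, if M contains an isotropic self-dual subgroup then |M| is a perfect square and σ(M) = 1. -/

import Mathlib

noncomputable section

/-- `ℚ/ℤ` as the additive circle of circumference 1. -/
abbrev QZ : Type := AddCircle (1 : ℚ)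

lemma expPeriodic : Function.Periodic
    (fun q : ℚ => Complex.exp (2 * Real.pi * Complex.I * (q : ℂ))) 1 := by
  intro x
  push_cast
  rw [mul_add, Complex.exp_add, mul_one, Complex.exp_two_pi_mul_I, mul_one]

/-- The standard character `e : ℚ/ℤ → ℂ`, `e(t) = exp(2πi t)`. -/
def ee : QZ → ℂ := expPeriodic.lift

variable {M : Type} [AddCommGroup M]

/-- The bilinear form associated to a quadratic form `Q : M → ℚ/ℤ`. -/
def Bf (Q : M → QZ) (x y : M) : QZ := Q (x + y) - Q x - Q y

/-- The Gauss sum `σ(M) = |M|^{-1/2} ∑_{x ∈ M} e(-Q(x))`. -/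
def gaussSigma (Q : M → QZ) : ℂ :=
  ((Real.sqrt (Nat.card M) : ℂ))⁻¹ * ∑ᶠ x : M, ee (-(Q x))

/-- The operator `T_M` of the Weil representation: `(T_M λ)(x) = e(Q(x))·λ(x)`. -/
def Tweil (Q : M → QZ) (lam : M → ℂ) : M → ℂ := fun x => ee (Q x) * lam x

/-- The operator `S_M` of the Weil representation:
`(S_M λ)(y) = σ(M)·|M|^{-1/2}·∑_{x∈M} e(-B(y,x))·λ(x)`. -/
def Sweil (Q : M → QZ) (lam : M → ℂ) : M → ℂ := fun y =>
  gaussSigma Q * ((Real.sqrt (Nat.card M) : ℂ))⁻¹ *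
    ∑ᶠ x : M, ee (-(Bf Q y x)) * lam x

/-- The `p`-primary component of an abelian group, as a subgroup. -/
def primaryComp (M : Type) [AddCommGroup M] (p : ℕ) : AddSubgroup M where
  carrier := {x | ∃ k : ℕ, (p ^ k : ℕ) • x = 0}
  zero_mem' := ⟨0, smul_zero _⟩
  add_mem' := by
    rintro a b ⟨k, hk⟩ ⟨l, hl⟩
    refine ⟨k + l, ?_⟩
    have ha : (p ^ (k + l) : ℕ) • a = 0 := by
      rw [pow_add, mul_comm, mul_smul, hk, smul_zero]
    have hb : (p ^ (k + l) : ℕ) • b = 0 := by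
      rw [pow_add, mul_smul, hl, smul_zero]
    rw [smul_add, ha, hb, add_zero]
  neg_mem' := by
    rintro a ⟨k, hk⟩
    exact ⟨k, by rw [smul_neg, hk, neg_zero]⟩

end

lemma ee_coe (q : ℚ) : ee (q : QZ) = Complex.exp (2 * Real.pi * Complex.I * (q : ℂ)) := rfl

lemma ee_add (a b : QZ) : ee (a + b) = ee a * ee b := by
  induction a using QuotientAddGroup.induction_on with | _ a =>
  induction b using QuotientAddGroup.induction_on with | _ b =>
  have := ee_coe (a + b)
  rw [AddCircle.coe_add] at this
  refine this.trans ?_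
  rw [show ee (a : QZ) = _ from ee_coe a, show ee (b : QZ) = _ from ee_coe b, ← Complex.exp_add]
  push_cast
  ring_nf

lemma ee_zero : ee 0 = 1 := by
  have := ee_coe 0
  rw [AddCircle.coe_zero] at this
  rw [this]; simp

lemma ee_eq_one {a : QZ} (h : ee a = 1) : a = 0 := by
  induction a using QuotientAddGroup.induction_on with | _ a =>
  rw [show ee (a : QZ) = _ from ee_coe a, Complex.exp_eq_one_iff] at h
  obtain ⟨n, hn⟩ := h
  have h2 : (2 * Real.pi * Complex.I : ℂ) ≠ 0 := Complex.two_pi_I_ne_zero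
  rw [mul_comm] at hn
  have h3 : (a : ℂ) = n := mul_right_cancel₀ h2 hn
  have h4 : a = n := by exact_mod_cast h3
  refine (AddCircle.coe_eq_zero_iff (1 : ℚ)).2 ⟨n, ?_⟩
  simp [h4]

lemma sum_ee {A : Type} [AddCommGroup A] [Fintype A] (f : A → QZ)
    (hf : ∀ x y, f (x + y) = f x + f y) [Decidable (∀ x, f x = 0)] :
    ∑ x, ee (f x) = if ∀ x, f x = 0 then (Nat.card A : ℂ) else 0 := by
  classical
  have h0 : f 0 = 0 := by simpa using hf 0 0
  let ψ : AddChar A ℂ :=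
    { toFun := fun x => ee (f x)
      map_zero_eq_one' := by rw [h0, ee_zero]
      map_add_eq_mul' := fun x y => by rw [hf, ee_add] }
  have h := AddChar.sum_eq_ite ψ
  have hiff : ψ = 0 ↔ ∀ x, f x = 0 := by
    constructor
    · intro h x
      apply ee_eq_one
      exact DFunLike.congr_fun h x
    · intro h
      ext x
      change ee (f x) = 1
      rw [h, ee_zero]
  rw [Nat.card_eq_fintype_card]
  simp only [hiff] at h
  exact h

lemma Bf_comm' {M : Type} [AddCommGroup M] (Q : M → QZ) (x y : M) : Bf Q x y = Bf Q y x := by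
  unfold Bf; rw [add_comm x y]; abel

lemma Bf_add_right' {M : Type} [AddCommGroup M] (Q : M → QZ)
    (hbil : ∀ x x' y : M, Bf Q (x + x') y = Bf Q x y + Bf Q x' y) (x y y' : M) :
    Bf Q x (y + y') = Bf Q x y + Bf Q x y' := by
  rw [Bf_comm', hbil, Bf_comm' Q y, Bf_comm' Q y']

lemma card_perp {M : Type} [AddCommGroup M] [Finite M] (Q : M → QZ)
    (hbil : ∀ x x' y : M, Bf Q (x + x') y = Bf Q x y + Bf Q x' y)
    (hnd : ∀ x : M, (∀ y : M, Bf Q x y = 0) → x = 0)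
    (U Up : AddSubgroup M)
    (hUp : ∀ y : M, y ∈ Up ↔ ∀ x ∈ U, Bf Q x y = 0) :
    Nat.card M = Nat.card U * Nat.card Up := by
  classical
  have := Fintype.ofFinite M
  have e1 : ∑ x : M, ∑ u : U, ee (Bf Q u x) = (Nat.card U * Nat.card Up : ℂ) := by
    have : ∀ x : M, ∑ u : U, ee (Bf Q u x) = if x ∈ Up then (Nat.card U : ℂ) else 0 := by
      intro x
      rw [sum_ee (fun u : U => Bf Q u x) (fun a b => by simp [hbil])]
      have : (∀ u : U, Bf Q u x = 0) ↔ x ∈ Up := by rw [hUp]; simp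
      simp only [this]
    simp only [this]
    rw [← Finset.sum_filter, Finset.sum_const, nsmul_eq_mul, mul_comm]
    congr 2
    rw [Nat.card_eq_fintype_card, Fintype.card_subtype]
  have e2 : ∑ x : M, ∑ u : U, ee (Bf Q u x) = (Nat.card M : ℂ) := by
    rw [Finset.sum_comm]
    have : ∀ u : U, ∑ x : M, ee (Bf Q u x) = if u = 0 then (Nat.card M : ℂ) else 0 := by
      intro u
      rw [sum_ee (fun x : M => Bf Q u x) (fun a b => Bf_add_right' Q hbil _ _ _)]
      have : (∀ x : M, Bf Q u x = 0) ↔ u = 0 := by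
        constructor
        · intro h
          exact Subtype.ext (hnd _ h)
        · rintro rfl x
          simpa using hbil 0 0 x
      simp only [this]
    simp [this]
  rw [e2] at e1
  exact_mod_cast e1

lemma sum_perp {M : Type} [AddCommGroup M] [Fintype M] (Q : M → QZ)
    (hbil : ∀ x x' y : M, Bf Q (x + x') y = Bf Q x y + Bf Q x' y)
    (U Up : AddSubgroup M) [Fintype Up]
    (hiso : ∀ x ∈ U, Q x = 0)
    (hUp : ∀ y : M, y ∈ Up ↔ ∀ x ∈ U, Bf Q x y = 0) :
    ∑ x : M, ee (-Q x) = ∑ x : Up, ee (-Q x) := by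
  classical
  have hU : (Nat.card U : ℂ) ≠ 0 := by exact_mod_cast Nat.card_pos.ne'
  apply mul_left_cancel₀ hU
  have h1 : ∑ u : U, ∑ x : M, ee (-Q (u + x)) = Nat.card U * ∑ x : M, ee (-Q x) := by
    have : ∀ u : U, ∑ x : M, ee (-Q (u + x)) = ∑ x : M, ee (-Q x) := fun u =>
      Fintype.sum_equiv (Equiv.addLeft (u : M)) _ _ (fun x => rfl)
    simp [this]
  rw [← h1, Finset.sum_comm]
  have h2 : ∀ x : M, ∑ u : U, ee (-Q (u + x)) =
      if x ∈ Up then (Nat.card U : ℂ) * ee (-Q x) else 0 := by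
    intro x
    have : ∀ u : U, ee (-Q (u + x)) = ee (-Bf Q u x) * ee (-Q x) := by
      intro u
      rw [← ee_add]
      congr 1
      unfold Bf
      rw [hiso u u.2]
      abel
    simp only [this]
    rw [← Finset.sum_mul,
      sum_ee (fun u : U => -Bf Q u x) (fun a b => by simp [hbil]; abel)]
    have : (∀ u : U, -Bf Q u x = 0) ↔ x ∈ Up := by rw [hUp]; simp
    simp only [this]
    split_ifs <;> simp
  simp only [h2]
  rw [← Finset.sum_filter, Finset.mul_sum]
  exact Finset.sum_subtype (p := fun x => x ∈ Up) _ (by simp)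
    (fun x => (Nat.card U : ℂ) * ee (-Q x))

lemma sum_quot {G : Type} [AddCommGroup G] [Fintype G] (H : AddSubgroup G) [Fintype (G ⧸ H)]
    (f : G ⧸ H → ℂ) : ∑ x : G, f (QuotientAddGroup.mk x) = Nat.card H * ∑ q, f q := by
  classical
  have hb : Function.Bijective (fun p : (G ⧸ H) × H => p.1.out + (p.2 : G)) := by
    constructor
    · rintro ⟨a, h⟩ ⟨b, k⟩ hab
      simp only at hab
      have : a = b := by
        have := congrArg (QuotientAddGroup.mk (s := H)) hab
        simpa using this
      subst this
      simpa using hab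
    · intro x
      refine ⟨⟨QuotientAddGroup.mk x, ⟨-(QuotientAddGroup.mk x : G ⧸ H).out + x, ?_⟩⟩, by simp⟩
      rw [← QuotientAddGroup.eq]; simp
  rw [← hb.sum_comp, Fintype.sum_prod_type, Finset.mul_sum]
  refine Finset.sum_congr rfl fun q _ => ?_
  simp

/-- for an isotropic subgroup `U` of a nondegenerate finite quadratic
module `(M,Q)` with dual `U^⊥`: (i) `Q` descends to a well-defined quadratic form
`Q̄` on `U^⊥/U` making it a nondegenerate finite quadratic module; (ii)
`|M| = |U|²·|U^⊥/U|`; (iii) `σ(M) = σ(U^⊥/U)`. In particular, if `U` is moreover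
self-dual then `|M|` is a perfect square and `σ(M) = 1`. -/
theorem isotropic_quotient {M : Type} [AddCommGroup M] [Finite M] (Q : M → QZ)
    (hquad : ∀ (n : ℤ) (x : M), Q (n • x) = (n ^ 2 : ℤ) • Q x)
    (hbil : ∀ x x' y : M, Bf Q (x + x') y = Bf Q x y + Bf Q x' y)
    (hnd : ∀ x : M, (∀ y : M, Bf Q x y = 0) → x = 0)
    (U Up : AddSubgroup M)
    (hiso : ∀ x ∈ U, Q x = 0)
    (hUp : ∀ y : M, y ∈ Up ↔ ∀ x ∈ U, Bf Q x y = 0) :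
    (∀ x y : M, x ∈ Up → y ∈ Up → x - y ∈ U → Q x = Q y) ∧
    ∃ Qbar : (Up ⧸ U.addSubgroupOf Up) → QZ,
      (∀ x : Up, Qbar (QuotientAddGroup.mk x) = Q x) ∧
      (∀ (n : ℤ) (a : Up ⧸ U.addSubgroupOf Up), Qbar (n • a) = (n ^ 2 : ℤ) • Qbar a) ∧
      (∀ a a' b : Up ⧸ U.addSubgroupOf Up,
        Bf Qbar (a + a') b = Bf Qbar a b + Bf Qbar a' b) ∧
      (∀ a : Up ⧸ U.addSubgroupOf Up, (∀ b, Bf Qbar a b = 0) → a = 0) ∧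
      Nat.card M = Nat.card U ^ 2 * Nat.card (Up ⧸ U.addSubgroupOf Up) ∧
      gaussSigma Q = gaussSigma Qbar ∧
      (Up = U → (∃ k : ℕ, Nat.card M = k ^ 2) ∧ gaussSigma Q = 1) := by
  classical
  have := Fintype.ofFinite M
  have key : ∀ x y : M, x ∈ Up → y ∈ Up → x - y ∈ U → Q x = Q y := by
    intro x y hx hy hxy
    have h := (hUp y).1 hy _ hxy
    unfold Bf at h
    rw [hiso _ hxy, sub_add_cancel, sub_zero, sub_eq_zero] at h
    exact h
  have hBsub : ∀ x ∈ U, ∀ y ∈ U, Bf Q x y = 0 := by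
    intro x hx y hy
    unfold Bf
    rw [hiso _ hx, hiso _ hy, hiso _ (U.add_mem hx hy)]; simp
  have hle : U ≤ Up := fun y hy => (hUp y).2 fun x hx => hBsub x hx y hy
  let N := U.addSubgroupOf Up
  let Qbar : (Up ⧸ N) → QZ := fun a => Quotient.liftOn' a (fun x : Up => Q x) (by
    intro x y hxy
    rw [QuotientAddGroup.leftRel_apply, AddSubgroup.mem_addSubgroupOf] at hxy
    refine (key y x y.2 x.2 ?_).symm
    simpa [sub_eq_add_neg, add_comm] using hxy)
  have hmk : ∀ x : Up, Qbar (QuotientAddGroup.mk x) = Q x := fun x => rfl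
  have hBmk : ∀ x y : Up, Bf Qbar (QuotientAddGroup.mk x) (QuotientAddGroup.mk y) = Bf Q x y := by
    intro x y
    unfold Bf
    rw [← QuotientAddGroup.mk_add, hmk, hmk, hmk]; rfl
  have hcN : Nat.card N = Nat.card U :=
    Nat.card_congr (AddSubgroup.addSubgroupOfEquivOfLe hle).toEquiv
  have hcUp : Nat.card Up = Nat.card (Up ⧸ N) * Nat.card U := by
    rw [← hcN]; exact AddSubgroup.card_eq_card_quotient_mul_card_addSubgroup N
  have hcM := card_perp Q hbil hnd U Up hUp
  have hcard : Nat.card M = Nat.card U ^ 2 * Nat.card (Up ⧸ N) := by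
    rw [hcM, hcUp]; ring
  have hsum : ∑ x : M, ee (-Q x) = Nat.card U * ∑ q : Up ⧸ N, ee (-Qbar q) := by
    rw [sum_perp Q hbil U Up hiso hUp, ← hcN, ← sum_quot N (fun q => ee (-Qbar q))]
    rfl
  have hUpos : (Nat.card U : ℂ) ≠ 0 := by exact_mod_cast Nat.card_pos.ne'
  have hsig : gaussSigma Q = gaussSigma Qbar := by
    unfold gaussSigma
    rw [finsum_eq_sum_of_fintype, finsum_eq_sum_of_fintype, hsum, hcard]
    push_cast
    rw [Real.sqrt_mul (by positivity), Real.sqrt_sq (by positivity)]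
    push_cast
    rw [mul_inv]
    field_simp
  refine ⟨key, Qbar, hmk, ?_, ?_, ?_, hcard, hsig, ?_⟩
  · intro n a
    induction a using QuotientAddGroup.induction_on with | _ x =>
    rw [← QuotientAddGroup.mk_zsmul, hmk, hmk]
    exact hquad n x
  · intro a a' b
    induction a using QuotientAddGroup.induction_on with | _ x =>
    induction a' using QuotientAddGroup.induction_on with | _ x' =>
    induction b using QuotientAddGroup.induction_on with | _ y =>
    rw [← QuotientAddGroup.mk_add, hBmk, hBmk, hBmk]
    exact hbil x x' y
  · intro a ha
    induction a using QuotientAddGroup.induction_on with | _ x =>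
    have hx : ∀ y ∈ Up, Bf Q y x = 0 := by
      intro y hy
      rw [Bf_comm', ← hBmk x ⟨y, hy⟩]
      exact ha _
    let Upp : AddSubgroup M :=
      { carrier := {y | ∀ x ∈ Up, Bf Q x y = 0}
        zero_mem' := fun z _ => by simpa using Bf_add_right' Q hbil z 0 0
        add_mem' := fun {a b} h h' z hz => by
          rw [Bf_add_right' Q hbil, h z hz, h' z hz, add_zero]
        neg_mem' := fun {a} h z hz => by
          have h0 : Bf Q z 0 = 0 := by simpa using Bf_add_right' Q hbil z 0 0
          have := Bf_add_right' Q hbil z a (-a)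
          rw [add_neg_cancel, h0, h z hz, zero_add] at this
          exact this.symm }
    have hc2 := card_perp Q hbil hnd Up Upp (fun y => Iff.rfl)
    have hcc : Nat.card Upp = Nat.card U := by
      rw [hcM, mul_comm] at hc2
      exact (Nat.eq_of_mul_eq_mul_left Nat.card_pos hc2).symm
    have hle2 : U ≤ Upp := fun u hu z hz => by
      rw [Bf_comm']; exact (hUp z).1 hz u hu
    have heq : U = Upp := AddSubgroup.eq_of_le_of_card_ge hle2 hcc.le
    rw [QuotientAddGroup.eq_zero_iff, AddSubgroup.mem_addSubgroupOf, heq]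
    exact hx
  · intro h
    have hc1 : Nat.card (Up ⧸ N) = 1 := by
      have : Nat.card Up = Nat.card U := by rw [h]
      rw [this] at hcUp
      exact (Nat.eq_of_mul_eq_mul_right (Nat.card_pos (α := U)) (by rw [one_mul]; exact hcUp)).symm
    refine ⟨⟨Nat.card U, by rw [hcard, hc1, mul_one]⟩, ?_⟩
    rw [hsig]
    unfold gaussSigma
    have hs : Subsingleton (Up ⧸ N) := (Nat.card_eq_one_iff_unique.1 hc1).1
    have hz : ∀ q : Up ⧸ N, ee (-Qbar q) = 1 := by
      intro q
      rw [Subsingleton.elim q (QuotientAddGroup.mk 0), hmk, AddSubgroup.coe_zero,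
        hiso 0 U.zero_mem, neg_zero, ee_zero]
    rw [finsum_eq_sum_of_fintype, hc1]
    simp only [hz]
    rw [Finset.sum_const, Finset.card_univ, ← Nat.card_eq_fintype_card, hc1]
    simp
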